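/- Let a, b, c ∈ ℚ and let g ∈ ℚ[[X]] be the unique power series with constant coefficient 1 satisfying X²(b + cX)·g² + (1 − aX − bX²)·g = 1. Set f := −X·g (a power series with zero constant coefficient). Then f(f(X)) = X (i.e., substituting f into itself gives X) and g·g(f(X)) = 1 (i.e., g times the series obtained by substituting f into g equals 1). Equivalently, the generating function g(x) = (1/(1 − ax − bx²))·c(−x²(b + cx)/(1 − ax − bx²)²) is involutory: the Riordan array (g(x), −xg(x)) squares to the identity, so (g(x), xg(x)) is a Bell pseudo-involution. -/

import Mathlib

open PowerSeries

/-- Substitution of the power series `f` (intended: with zero constant coefficient) into the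
power series `g`: the `n`-th coefficient of `g(f)` is `∑_{k=0}^{n} gₖ · [Xⁿ] fᵏ`. -/
noncomputable def substSeries (f g : PowerSeries ℚ) : PowerSeries ℚ :=
  PowerSeries.mk fun n => ∑ k ∈ Finset.range (n + 1), coeff k g * coeff n (f ^ k)

theorem substSeries_eq (f g : PowerSeries ℚ) (hf : constantCoeff f = 0) :
    substSeries f g = g.subst f := by
  ext n
  rw [coeff_subst' (HasSubst.of_constantCoeff_zero' hf), substSeries, coeff_mk]
  symm
  simp only [smul_eq_mul]
  apply finsum_eq_sum_of_support_subset
  intro k hk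
  simp only [Function.mem_support] at hk
  by_contra hk2
  apply hk
  have hlt : n < k := by simpa using hk2
  have : coeff n (f ^ k) = 0 := by
    have hd : X ^ k ∣ f ^ k := pow_dvd_pow_of_dvd (X_dvd_iff.mpr hf) k
    exact X_pow_dvd_iff.mp hd n hlt
  rw [this, mul_zero]

/-- If `g` is the power series with constant coefficient `1` satisfying
`X²(b + cX)·g² + (1 − aX − bX²)·g = 1`, and `f := −X·g`, then `f(f(X)) = X` and
`g · g(f(X)) = 1`; i.e. `g` is involutory, so `(g(x), xg(x))` is a Bell pseudo-involution. -/
theorem stmt_7 (a b c : ℚ) (g : PowerSeries ℚ)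
    (hg0 : constantCoeff g = 1)
    (hg : X ^ 2 * (C b + C c * X) * g ^ 2 + (1 - C a * X - C b * X ^ 2) * g = 1) :
    substSeries (-(X * g)) (-(X * g)) = X ∧ g * substSeries (-(X * g)) g = 1 := by
  have hf : constantCoeff (-(X * g)) = 0 := by simp
  have hs : HasSubst (-(X * g)) := HasSubst.of_constantCoeff_zero' hf
  rw [substSeries_eq _ _ hf, substSeries_eq _ _ hf]
  obtain ⟨φ, hφ⟩ : ∃ φ : PowerSeries ℚ →ₐ[ℚ] PowerSeries ℚ, ∀ p, p.subst (-(X * g)) = φ p :=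
    ⟨substAlgHom hs, fun p => by rw [coe_substAlgHom]⟩
  have hX : φ X = -(X * g) := by rw [← hφ, subst_X hs]
  have hC : ∀ r, φ (C r) = C r := fun r => φ.commutes r
  have h2 := congrArg φ hg
  simp only [map_add, map_mul, map_pow, map_sub, map_one, hX, hC] at h2
  rw [hφ, hφ]
  simp only [map_neg, map_mul, hX]
  generalize φ g = h at h2
  have key : (g * h - 1) * (X ^ 2 * g * (C b - C c * X * g) * (g * h + 1)
      + (1 + C a * X * g - C b * X ^ 2 * g ^ 2)) = 0 := by
    linear_combination g * h2 + hg
  have hne : (X ^ 2 * g * (C b - C c * X * g) * (g * h + 1)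
      + (1 + C a * X * g - C b * X ^ 2 * g ^ 2)) ≠ 0 := by
    intro h0
    have := congrArg constantCoeff h0
    simp at this
  have hd : g * h = 1 := sub_eq_zero.mp ((mul_eq_zero.mp key).resolve_right hne)
  exact ⟨by linear_combination X * hd, hd⟩
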